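/- Let N ≥ 2 be an integer, let k be a nonnegative integer and let s be a real number. Then for every x ∈ ℝ^N \ {0} and every y ∈ ℝ^{N−1} \ {0}, |x|^{2(k−s)} · |∇_N^k u_s(x)|² = k! · Σ_{l=0}^{⌊k/2⌋} ((k−2l)!/(2l)!) · ( Σ_{n=⌈k/2⌉}^{k−l} 2^{2n−k} · C(s/2, n) · C(n, k−n) · C(k−n, l) )² · |∇_{N−1}^{2l} p_l(y)|², where u_s(x) = |x|^s on ℝ^N and p_l(y) = |y|^{2l} on ℝ^{N−1}. -/

import Mathlib

open scoped BigOperators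

/-- The partial derivative `∂ᵢ` of a real-valued function on `ℝ^N`. -/
noncomputable def pd {N : ℕ} (i : Fin N) (u : EuclideanSpace ℝ (Fin N) → ℝ) :
    EuclideanSpace ℝ (Fin N) → ℝ :=
  fun x => fderiv ℝ u x (EuclideanSpace.single i 1)

/-- Iterated partial derivative `D_i = ∂_{i₁} ∂_{i₂} ⋯ ∂_{i_k}` for a list of indices. -/
noncomputable def pdIter {N : ℕ} (l : List (Fin N)) (u : EuclideanSpace ℝ (Fin N) → ℝ) :
    EuclideanSpace ℝ (Fin N) → ℝ :=
  l.foldr pd u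

/-- `|∇_N^k u(x)|² = Σ_{i ∈ {1,…,N}^k} (D_i u(x))²`. -/
noncomputable def gradSq (N k : ℕ) (u : EuclideanSpace ℝ (Fin N) → ℝ)
    (x : EuclideanSpace ℝ (Fin N)) : ℝ :=
  ∑ i : Fin k → Fin N, (pdIter (List.ofFn i) u x) ^ 2

/-- The falling factorial `(ν)_k = ν(ν−1)⋯(ν−k+1)`. -/
noncomputable def ffac (ν : ℝ) (k : ℕ) : ℝ := ∏ j ∈ Finset.range k, (ν - j)

/-- The generalized binomial coefficient `C(ν,k) = (ν)_k / k!`. -/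
noncomputable def gchoose (ν : ℝ) (k : ℕ) : ℝ := ffac ν k / (Nat.factorial k)


/-- Evaluation of the space variables, keeping the formal variable. -/
noncomputable def evx {N : ℕ} (x : EuclideanSpace ℝ (Fin N)) :
    MvPolynomial (Option (Fin N)) ℝ →ₐ[ℝ] Polynomial ℝ :=
  MvPolynomial.aeval (fun o => o.elim Polynomial.X (fun i => Polynomial.C (x i)))

/-- The functional replacing `z^a` by `c a`. -/
noncomputable def lfun (c : ℕ → ℝ) : Polynomial ℝ →ₗ[ℝ] ℝ :=
  Polynomial.lsum (fun a => LinearMap.mulRight ℝ (c a))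

lemma lfun_monomial (c : ℕ → ℝ) (a : ℕ) (r : ℝ) :
    lfun c (Polynomial.monomial a r) = r * c a := by
  simp [lfun, Polynomial.lsum_apply, Polynomial.sum_monomial_index]

lemma lfun_mul_X (c : ℕ → ℝ) (P : Polynomial ℝ) :
    lfun c (P * Polynomial.X) = lfun (fun a => c (a + 1)) P := by
  induction P using Polynomial.induction_on' with
  | add p q hp hq => rw [add_mul, map_add, map_add, hp, hq]
  | monomial n a => rw [Polynomial.monomial_mul_X, lfun_monomial, lfun_monomial]

lemma lfun_eq_sum (c : ℕ → ℝ) (P : Polynomial ℝ) (n : ℕ) (h : P.natDegree < n) :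
    lfun c P = ∑ a ∈ Finset.range n, P.coeff a * c a := by
  rw [lfun, Polynomial.lsum_apply, Polynomial.sum_over_range' _ _ n h]
  · rfl
  · intro a; simp

lemma key_deriv {N : ℕ} (U : Set (EuclideanSpace ℝ (Fin N)))
    (P : MvPolynomial (Option (Fin N)) ℝ) :
    ∀ (v : ℕ → EuclideanSpace ℝ (Fin N) → ℝ)
    (_ : ∀ a, ∀ x ∈ U, HasFDerivAt (v a) (v (a + 1) x • innerSL ℝ x) x)
    (x : EuclideanSpace ℝ (Fin N)) (_ : x ∈ U),
    DifferentiableAt ℝ (fun x => lfun (fun a => v a x) (evx x P)) x ∧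
    ∀ j, fderiv ℝ (fun x => lfun (fun a => v a x) (evx x P)) x (EuclideanSpace.single j 1) =
      lfun (fun a => v a x) (evx x
        (MvPolynomial.pderiv (some j) P +
          MvPolynomial.X none * MvPolynomial.X (some j) * P)) := by
  induction P using MvPolynomial.induction_on with
  | C r =>
    intro v hv x hx
    have e : (fun x => lfun (fun a => v a x) (evx x (MvPolynomial.C r))) = fun x => r * v 0 x := by
      funext x
      have : evx x (MvPolynomial.C r) = Polynomial.monomial 0 r := by
        simp [evx]
      rw [this, lfun_monomial]
    rw [e]
    have h := (hv 0 x hx).const_mul r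
    refine ⟨h.differentiableAt, fun j => ?_⟩
    rw [h.fderiv]
    have : evx x (MvPolynomial.pderiv (some j) (MvPolynomial.C r) +
          MvPolynomial.X none * MvPolynomial.X (some j) * MvPolynomial.C r)
          = Polynomial.monomial 1 (r * x j) := by
      simp [evx, ← Polynomial.C_mul_X_eq_monomial]
      ring
    rw [this, lfun_monomial]
    simp [EuclideanSpace.inner_single_right]
    ring
  | add p q hp hq =>
    intro v hv x hx
    obtain ⟨h1, h2⟩ := hp v hv x hx
    obtain ⟨h3, h4⟩ := hq v hv x hx
    have e : (fun x => lfun (fun a => v a x) (evx x (p + q))) =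
      fun x => lfun (fun a => v a x) (evx x p) + lfun (fun a => v a x) (evx x q) := by
      funext x; simp
    rw [e]
    refine ⟨h1.add h3, fun j => ?_⟩
    rw [fderiv_fun_add h1 h3, add_apply, h2, h4, ← map_add, ← map_add]
    congr 2
    rw [map_add]; ring
  | mul_X p o hp =>
    intro v hv x hx
    cases o with
    | none =>
      have e : (fun x => lfun (fun a => v a x) (evx x (p * MvPolynomial.X none))) =
        fun x => lfun (fun a => v (a + 1) x) (evx x p) := by
        funext x
        have : evx x (p * MvPolynomial.X none) = evx x p * Polynomial.X := by simp [evx]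
        rw [this, lfun_mul_X]
      rw [e]
      obtain ⟨h1, h2⟩ := hp (fun a => v (a + 1)) (fun a => hv (a + 1)) x hx
      refine ⟨h1, fun j => ?_⟩
      rw [h2 j]
      have : evx x (MvPolynomial.pderiv (some j) (p * MvPolynomial.X none) +
          MvPolynomial.X none * MvPolynomial.X (some j) * (p * MvPolynomial.X none)) =
          evx x (MvPolynomial.pderiv (some j) p +
          MvPolynomial.X none * MvPolynomial.X (some j) * p) * Polynomial.X := by
        have h3 : (Polynomial.X : Polynomial ℝ) = evx x (MvPolynomial.X none) := by simp [evx]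
        rw [h3, ← map_mul]
        congr 1
        rw [Derivation.leibniz, MvPolynomial.pderiv_X_of_ne (by simp)]
        simp only [smul_eq_mul]
        ring
      rw [this, lfun_mul_X]
    | some i =>
      have e0 : ∀ (q : MvPolynomial (Option (Fin N)) ℝ) (x : EuclideanSpace ℝ (Fin N)),
          lfun (fun a => v a x) (evx x (q * MvPolynomial.X (some i))) =
          lfun (fun a => v a x) (evx x q) * x i := by
        intro q x
        have : evx x (q * MvPolynomial.X (some i)) = x i • evx x q := by
          simp [evx, Polynomial.smul_eq_C_mul, mul_comm]
        rw [this, map_smul, smul_eq_mul, mul_comm]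
      have e : (fun x => lfun (fun a => v a x) (evx x (p * MvPolynomial.X (some i)))) =
        fun x => lfun (fun a => v a x) (evx x p) * x i := by
        funext x; exact e0 p x
      rw [e]
      obtain ⟨h1, h2⟩ := hp v hv x hx
      have h3 : HasFDerivAt (fun x : EuclideanSpace ℝ (Fin N) => x i)
        (EuclideanSpace.proj i : EuclideanSpace ℝ (Fin N) →L[ℝ] ℝ) x :=
        (EuclideanSpace.proj i : EuclideanSpace ℝ (Fin N) →L[ℝ] ℝ).hasFDerivAt
      have h4 := h1.hasFDerivAt.fun_mul h3
      refine ⟨h4.differentiableAt, fun j => ?_⟩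
      rw [h4.fderiv]
      have h5 : MvPolynomial.pderiv (some j) (p * MvPolynomial.X (some i)) +
          MvPolynomial.X none * MvPolynomial.X (some j) * (p * MvPolynomial.X (some i)) =
          (MvPolynomial.pderiv (some j) p +
          MvPolynomial.X none * MvPolynomial.X (some j) * p) * MvPolynomial.X (some i) +
          MvPolynomial.C (if i = j then 1 else 0) * p := by
        rw [Derivation.leibniz, MvPolynomial.pderiv_X]
        simp only [smul_eq_mul, Pi.single_apply, Option.some.injEq]
        by_cases hij : i = j
        · simp [hij]; ring
        · simp [hij]; ring
      have h6 : evx x (MvPolynomial.C (if i = j then 1 else 0) * p) =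
          (if i = j then (1 : ℝ) else 0) • evx x p := by
        split_ifs <;> simp
      rw [h5, map_add, map_add, h6, map_smul, e0, ← h2 j]
      simp [PiLp.single_apply]
      split_ifs <;> ring

/-- Hermite-like polynomials `e^{-z x²/2} ∂^m e^{z x²/2}` in the `j`-th variable. -/
noncomputable def hmt {R : Type*} [CommRing R] (z t : R) : ℕ → R
  | 0 => 1
  | 1 => z * t
  | (m + 2) => z * t * hmt z t (m + 1) + ((m : R) + 1) * z * hmt z t m

lemma hmt_pderiv {N : ℕ} (i j : Fin N) (m : ℕ) :
    MvPolynomial.pderiv (some i) (hmt (R := MvPolynomial (Option (Fin N)) ℝ)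
      (MvPolynomial.X none) (MvPolynomial.X (some j)) m) =
    if i = j then (m : MvPolynomial (Option (Fin N)) ℝ) * MvPolynomial.X none *
      hmt (MvPolynomial.X none) (MvPolynomial.X (some j)) (m - 1) else 0 := by
  induction m using Nat.twoStepInduction with
  | zero => simp [hmt]
  | one =>
    simp only [hmt, Derivation.leibniz, MvPolynomial.pderiv_X, smul_eq_mul, Pi.single_apply]
    by_cases h : i = j
    · simp [h, hmt]
    · simp [h, eq_comm]
  | more m h1 h2 =>
    rw [hmt]
    have h3 : MvPolynomial.pderiv (some i) ((m : MvPolynomial (Option (Fin N)) ℝ) + 1) = 0 := by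
      simp
    have h4 : MvPolynomial.pderiv (some i)
        (MvPolynomial.X none : MvPolynomial (Option (Fin N)) ℝ) = 0 :=
      MvPolynomial.pderiv_X_of_ne (by simp)
    simp only [map_add, Derivation.leibniz, h1, h2, smul_eq_mul, h4, MvPolynomial.pderiv_X,
      Pi.single_apply, h3]
    by_cases h : i = j
    · subst h
      simp only [if_true]
      rcases m with _ | m
      · simp [hmt]; ring
      · simp only [Nat.add_sub_cancel, show m + 1 + 2 - 1 = m + 1 + 1 by omega]
        rw [hmt.eq_3 _ _ m]
        push_cast
        simp
        ring
    · simp [h, eq_comm]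

/-- The polynomial of a list of indices. -/
noncomputable def gpoly {R : Type*} [CommRing R] {N : ℕ} (z : R) (x : Fin N → R)
    (l : List (Fin N)) : R :=
  ∏ j, hmt z (x j) (l.count j)

lemma hmt_succ {R : Type*} [CommRing R] (z t : R) (m : ℕ) :
    hmt z t (m + 1) = z * t * hmt z t m + m * z * hmt z t (m - 1) := by
  rcases m with _ | m
  · simp [hmt]
  · simp [hmt]

lemma gpoly_cons {N : ℕ} (l : List (Fin N)) (j : Fin N) :
    MvPolynomial.pderiv (some j) (gpoly (R := MvPolynomial (Option (Fin N)) ℝ)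
      (MvPolynomial.X none) (fun j => MvPolynomial.X (some j)) l) +
      MvPolynomial.X none * MvPolynomial.X (some j) * gpoly (MvPolynomial.X none)
        (fun j => MvPolynomial.X (some j)) l =
    gpoly (MvPolynomial.X none) (fun j => MvPolynomial.X (some j)) (j :: l) := by
  unfold gpoly
  rw [← Finset.mul_prod_erase _ _ (Finset.mem_univ j), ← Finset.mul_prod_erase _ (fun i => hmt _ _ ((j :: l).count i)) (Finset.mem_univ j)]
  have h1 : ∀ s : Finset (Fin N), j ∉ s → MvPolynomial.pderiv (some j)
    (∏ i ∈ s, hmt (R := MvPolynomial (Option (Fin N)) ℝ)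
      (MvPolynomial.X none) (MvPolynomial.X (some i)) (l.count i)) = 0 := by
    intro s
    induction s using Finset.induction_on with
    | empty => intro _; simp
    | insert a s ha ih =>
      intro hj
      simp only [Finset.mem_insert, not_or] at hj
      rw [Finset.prod_insert ha, Derivation.leibniz, ih hj.2, hmt_pderiv, if_neg hj.1]
      simp
  have h2 : ∏ i ∈ Finset.univ.erase j, hmt (R := MvPolynomial (Option (Fin N)) ℝ)
      (MvPolynomial.X none) (MvPolynomial.X (some i)) ((j :: l).count i) =
      ∏ i ∈ Finset.univ.erase j, hmt (R := MvPolynomial (Option (Fin N)) ℝ)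
      (MvPolynomial.X none) (MvPolynomial.X (some i)) (l.count i) := by
    apply Finset.prod_congr rfl
    intro i hi
    rw [List.count_cons_of_ne (Finset.ne_of_mem_erase hi).symm]
  rw [h2, Derivation.leibniz, h1 _ (Finset.notMem_erase _ _), hmt_pderiv, if_pos rfl,
    List.count_cons_self, hmt_succ]
  simp only [smul_eq_mul]
  ring

lemma map_hmt {R S : Type*} [CommRing R] [CommRing S] (f : R →+* S) (z t : R) (m : ℕ) :
    f (hmt z t m) = hmt (f z) (f t) m := by
  induction m using Nat.twoStepInduction with
  | zero => simp [hmt]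
  | one => simp [hmt]
  | more m h1 h2 => simp [hmt, h1, h2]

/-- The polynomial of a list in the formal variable only. -/
noncomputable def gx {N : ℕ} (x : EuclideanSpace ℝ (Fin N)) (l : List (Fin N)) : Polynomial ℝ :=
  gpoly Polynomial.X (fun j => Polynomial.C (x j)) l

lemma evx_gpoly {N : ℕ} (x : EuclideanSpace ℝ (Fin N)) (l : List (Fin N)) :
    evx x (gpoly (MvPolynomial.X none) (fun j => MvPolynomial.X (some j)) l) = gx x l := by
  unfold gx gpoly
  rw [map_prod]
  apply Finset.prod_congr rfl
  intro j _
  have := map_hmt (evx x : MvPolynomial (Option (Fin N)) ℝ →+* Polynomial ℝ)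
    (MvPolynomial.X none) (MvPolynomial.X (some j)) (l.count j)
  simpa [evx] using this

lemma pdIter_eq {N : ℕ} (U : Set (EuclideanSpace ℝ (Fin N))) (hU : IsOpen U)
    (v : ℕ → EuclideanSpace ℝ (Fin N) → ℝ)
    (hv : ∀ a, ∀ x ∈ U, HasFDerivAt (v a) (v (a + 1) x • innerSL ℝ x) x)
    (l : List (Fin N)) : ∀ x ∈ U, pdIter l (v 0) x = lfun (fun a => v a x) (gx x l) := by
  induction l with
  | nil =>
    intro x _
    have : gx x [] = Polynomial.monomial 0 1 := by simp [gx, gpoly, hmt]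
    rw [this, lfun_monomial]; simp [pdIter]
  | cons j l ih =>
    intro x hx
    have e : pdIter (j :: l) (v 0) x = fderiv ℝ (pdIter l (v 0)) x (EuclideanSpace.single j 1) := rfl
    have : pdIter l (v 0) =ᶠ[nhds x] fun x => lfun (fun a => v a x) (evx x
        (gpoly (MvPolynomial.X none) (fun j => MvPolynomial.X (some j)) l)) := by
      filter_upwards [hU.mem_nhds hx] with y hy
      rw [ih y hy, evx_gpoly]
    rw [e, this.fderiv_eq, (key_deriv U _ v hv x hx).2 j, gpoly_cons, evx_gpoly]

lemma coeff_hmt (t : ℝ) (m : ℕ) : ∀ b : ℕ,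
    (hmt Polynomial.X (Polynomial.C t) m).coeff b =
    if m ≤ 2 * b ∧ b ≤ m then
      (m.factorial : ℝ) / (2 ^ (m - b) * (m - b).factorial * (2 * b - m).factorial) *
        t ^ (2 * b - m) else 0 := by
  induction m using Nat.twoStepInduction with
  | zero =>
    intro b
    rcases b with _ | b
    · simp [hmt]
    · simp [hmt, Polynomial.coeff_one]
  | one =>
    intro b
    rcases b with _ | _ | b
    · simp [hmt]
    · simp [hmt]
    · rw [hmt, Polynomial.coeff_X_mul]; simp
  | more m h1 h2 =>
    intro b
    have e : hmt Polynomial.X (Polynomial.C t) (m + 2) =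
      (Polynomial.C t * hmt Polynomial.X (Polynomial.C t) (m + 1) +
        Polynomial.C ((m : ℝ) + 1) * hmt Polynomial.X (Polynomial.C t) m) * Polynomial.X := by
      rw [hmt]; simp; ring
    rw [e]
    rcases b with _ | b
    · simp
    rw [Polynomial.coeff_mul_X, Polynomial.coeff_add, Polynomial.coeff_C_mul,
      Polynomial.coeff_C_mul, h1, h2]
    by_cases hc : m ≤ 2 * b ∧ b ≤ m + 1
    · obtain ⟨B, hB⟩ := Nat.exists_eq_add_of_le hc.1
      obtain ⟨A, hA⟩ := Nat.exists_eq_add_of_le hc.2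
      rw [if_pos (show m + 2 ≤ 2 * (b + 1) ∧ b + 1 ≤ m + 2 by omega)]
      rw [show m + 2 - (b + 1) = A by omega, show 2 * (b + 1) - (m + 2) = B by omega,
        show 2 * b - m = B by omega, show m + 1 - b = A by omega,
        show 2 * b - (m + 1) = B - 1 by omega, show m - b = A - 1 by omega]
      have hm : (m : ℝ) + 2 = 2 * A + B := by
        have : m + 2 = 2 * A + B := by omega
        exact_mod_cast this
      have f1 : ((m + 2).factorial : ℝ) = (2 * A + B) * ((m + 1).factorial : ℝ) := by
        rw [Nat.factorial_succ, ← hm]; push_cast; ring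
      have f2 : ((m + 1).factorial : ℝ) = (m + 1) * (m.factorial : ℝ) := by
        rw [Nat.factorial_succ]; push_cast; ring
      have hf : (m.factorial : ℝ) ≠ 0 := by positivity
      rw [f1, f2]
      rcases A with _ | A
      · rw [if_pos (by omega), if_neg (by omega)]
        rcases B with _ | B
        · omega
        · have : (B.factorial : ℝ) ≠ 0 := by positivity
          simp [Nat.factorial_succ]
          field_simp
          ring
      · rcases B with _ | B
        · rw [if_neg (by omega), if_pos (by omega)]
          have : (A.factorial : ℝ) ≠ 0 := by positivity
          simp [Nat.factorial_succ]
          field_simp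
          ring
        · rw [if_pos (by omega), if_pos (by omega)]
          have : (A.factorial : ℝ) ≠ 0 := by positivity
          have : (B.factorial : ℝ) ≠ 0 := by positivity
          simp [Nat.factorial_succ]
          field_simp
          ring
    · rw [if_neg (by omega), if_neg (by omega), if_neg (by omega)]; simp

lemma coeff_prod_aux {ι : Type*} (s : Finset ι) (P Q : ι → Polynomial ℝ) (m : ι → ℕ)
    (hP : ∀ j, ∀ a, 2 * a < m j → (P j).coeff a = 0)
    (hQ : ∀ j, ∀ a, 2 * a < m j → (Q j).coeff a = 0)
    (hPQ : ∀ j, ∀ a, 2 * a = m j → (P j).coeff a = (Q j).coeff a) :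
    (∀ a, 2 * a < ∑ j ∈ s, m j → (∏ j ∈ s, P j).coeff a = 0) ∧
    (∀ a, 2 * a < ∑ j ∈ s, m j → (∏ j ∈ s, Q j).coeff a = 0) ∧
    (∀ a, 2 * a = ∑ j ∈ s, m j → (∏ j ∈ s, P j).coeff a = (∏ j ∈ s, Q j).coeff a) := by
  classical
  induction s using Finset.induction_on with
  | empty => simp
  | insert i s hi ih =>
    obtain ⟨i1, i2, i3⟩ := ih
    simp only [Finset.prod_insert hi, Finset.sum_insert hi, Polynomial.coeff_mul]
    refine ⟨fun a ha => Finset.sum_eq_zero ?_, fun a ha => Finset.sum_eq_zero ?_,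
      fun a ha => Finset.sum_congr rfl ?_⟩
    · rintro ⟨b, c⟩ hbc
      rw [Finset.HasAntidiagonal.mem_antidiagonal] at hbc
      simp only at hbc ⊢
      by_cases h : 2 * b < m i
      · rw [hP i b h, zero_mul]
      · rw [i1 c (by omega), mul_zero]
    · rintro ⟨b, c⟩ hbc
      rw [Finset.HasAntidiagonal.mem_antidiagonal] at hbc
      simp only at hbc ⊢
      by_cases h : 2 * b < m i
      · rw [hQ i b h, zero_mul]
      · rw [i2 c (by omega), mul_zero]
    · rintro ⟨b, c⟩ hbc
      rw [Finset.HasAntidiagonal.mem_antidiagonal] at hbc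
      simp only at hbc ⊢
      rcases lt_trichotomy (2 * b) (m i) with h | h | h
      · rw [hP i b h, hQ i b h, zero_mul, zero_mul]
      · rw [hPQ i b h, i3 c (by omega)]
      · rw [i1 c (by omega), i2 c (by omega), mul_zero, mul_zero]

lemma coeff_prod_aux2 {ι : Type*} (s : Finset ι) (P : ι → Polynomial ℝ) (m : ι → ℕ)
    (hP : ∀ j, ∀ a, 2 * a ≠ m j → (P j).coeff a = 0) :
    ∀ a, 2 * a ≠ ∑ j ∈ s, m j → (∏ j ∈ s, P j).coeff a = 0 := by
  classical
  induction s using Finset.induction_on with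
  | empty =>
    intro a ha
    simp only [Finset.sum_empty] at ha
    rw [Finset.prod_empty, Polynomial.coeff_one, if_neg (by omega)]
  | insert i s hi ih =>
    simp only [Finset.prod_insert hi, Finset.sum_insert hi, Polynomial.coeff_mul]
    refine fun a ha => Finset.sum_eq_zero ?_
    rintro ⟨b, c⟩ hbc
    rw [Finset.HasAntidiagonal.mem_antidiagonal] at hbc
    simp only at hbc ⊢
    by_cases h : 2 * b = m i
    · rw [ih c (by omega), mul_zero]
    · rw [hP i b h, zero_mul]

lemma sum_count_eq {N : ℕ} (l : List (Fin N)) : ∑ j, l.count j = l.length := by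
  induction l with
  | nil => simp
  | cons a l ih =>
    simp [List.count_cons, Finset.sum_add_distrib, ih]

lemma coeff_gx_lt {N : ℕ} (y : EuclideanSpace ℝ (Fin N)) (l : List (Fin N)) (a : ℕ)
    (h : 2 * a < l.length) : (gx y l).coeff a = 0 := by
  rw [← sum_count_eq] at h
  refine (coeff_prod_aux Finset.univ (fun j => hmt Polynomial.X (Polynomial.C (y j)) (l.count j))
    (fun j => hmt Polynomial.X (Polynomial.C (y j)) (l.count j)) (fun j => l.count j) ?_ ?_ ?_).1 a h
  · intro j a h; rw [coeff_hmt, if_neg (by omega)]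
  · intro j a h; rw [coeff_hmt, if_neg (by omega)]
  · intro j a h; rfl

lemma coeff_gx_eq {N : ℕ} (y : EuclideanSpace ℝ (Fin N)) (l : List (Fin N)) (a : ℕ)
    (h : 2 * a = l.length) : (gx y l).coeff a = (gx 0 l).coeff a := by
  rw [← sum_count_eq] at h
  refine (coeff_prod_aux Finset.univ (fun j => hmt Polynomial.X (Polynomial.C (y j)) (l.count j))
    (fun j => hmt Polynomial.X (Polynomial.C ((0 : EuclideanSpace ℝ (Fin N)) j)) (l.count j))
    (fun j => l.count j) ?_ ?_ ?_).2.2 a h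
  · intro j a h; rw [coeff_hmt, if_neg (by omega)]
  · intro j a h; rw [coeff_hmt, if_neg (by omega)]
  · intro j a h; rw [coeff_hmt, coeff_hmt, ← h]; simp

lemma coeff_gx_zero {N : ℕ} (l : List (Fin N)) (a : ℕ)
    (h : 2 * a ≠ l.length) : (gx 0 l).coeff a = 0 := by
  rw [← sum_count_eq] at h
  refine coeff_prod_aux2 Finset.univ
    (fun j => hmt Polynomial.X (Polynomial.C ((0 : EuclideanSpace ℝ (Fin N)) j)) (l.count j))
    (fun j => l.count j) ?_ a h
  intro j a h; rw [coeff_hmt]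
  split_ifs with hc
  · have : 2 * a - l.count j ≠ 0 := by omega
    simp [this]
  · rfl

/-- The leading constant. -/
noncomputable def kap {N : ℕ} (l : List (Fin N)) : ℝ := (gx 0 l).coeff (l.length / 2)

lemma gx_zero_even {N : ℕ} (l : List (Fin N)) (a : ℕ) (h : l.length = 2 * a) :
    gx 0 l = Polynomial.monomial a (kap l) := by
  ext b
  rw [Polynomial.coeff_monomial]
  split_ifs with hb
  · rw [kap, h, ← hb]; congr 1; omega
  · exact coeff_gx_zero l b (by omega)

lemma gx_zero_odd {N : ℕ} (l : List (Fin N)) (h : l.length % 2 = 1) :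
    gx 0 l = 0 := by
  ext b
  rw [coeff_gx_zero l b (by omega), Polynomial.coeff_zero]

/-- Drop the zeros of a list. -/
def nz {n : ℕ} (l : List (Fin (n + 1))) : List (Fin n) :=
  l.filterMap (fun i => Fin.cases none some i)

lemma nz_nil {n : ℕ} : nz ([] : List (Fin (n + 1))) = [] := rfl
lemma nz_cons_zero {n : ℕ} (l : List (Fin (n + 1))) : nz (0 :: l) = nz l := rfl
lemma nz_cons_succ {n : ℕ} (j : Fin n) (l : List (Fin (n + 1))) :
    nz (j.succ :: l) = j :: nz l := by
  simp [nz]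

lemma nz_count {n : ℕ} (l : List (Fin (n + 1))) (j : Fin n) :
    (nz l).count j = l.count j.succ := by
  induction l with
  | nil => rfl
  | cons a l ih =>
    cases a using Fin.cases with
    | zero => simp [nz_cons_zero, ih, (Fin.succ_ne_zero j).symm]
    | succ i => simp [nz_cons_succ, ih, List.count_cons]

lemma nz_length {n : ℕ} (l : List (Fin (n + 1))) :
    (nz l).length + l.count 0 = l.length := by
  rw [← sum_count_eq l, ← sum_count_eq (nz l), Fin.sum_univ_succ, add_comm]
  simp [nz_count]

lemma gx_axis {n : ℕ} (r : ℝ) (l : List (Fin (n + 1))) :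
    gx (EuclideanSpace.single 0 r) l =
      hmt Polynomial.X (Polynomial.C r) (l.count 0) * gx 0 (nz l) := by
  unfold gx gpoly
  rw [Fin.prod_univ_succ]
  simp [nz_count]

lemma sum_nz {n : ℕ} (k : ℕ) : ∀ (φ : List (Fin n) → ℝ),
    ∑ i : Fin k → Fin (n + 1), φ (nz (List.ofFn i)) =
    ∑ m ∈ Finset.range (k + 1), (k.choose m : ℝ) * ∑ i : Fin m → Fin n, φ (List.ofFn i) := by
  have hcons : ∀ (q k : ℕ) (ψ : List (Fin q) → ℝ), ∑ i : Fin (k + 1) → Fin q, ψ (List.ofFn i) =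
      ∑ j, ∑ i : Fin k → Fin q, ψ (j :: List.ofFn i) := by
    intro q k ψ
    rw [← Fintype.sum_prod_type', ← (Fin.consEquiv (fun _ => Fin q)).sum_comp]
    apply Finset.sum_congr rfl
    rintro ⟨j, i⟩ _
    simp [Fin.consEquiv, List.ofFn_succ]
  induction k with
  | zero => intro φ; simp [nz]
  | succ k ih =>
    intro φ
    rw [hcons (n + 1) k (fun l => φ (nz l)), Fin.sum_univ_succ]
    simp only [nz_cons_zero, nz_cons_succ]
    rw [ih φ]
    have : ∀ j : Fin n, ∑ i : Fin k → Fin (n + 1), φ (j :: nz (List.ofFn i)) =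
      ∑ m ∈ Finset.range (k + 1), (k.choose m : ℝ) * ∑ i : Fin m → Fin n, φ (j :: List.ofFn i) :=
      fun j => ih (fun l => φ (j :: l))
    simp only [this]
    rw [Finset.sum_comm]
    simp only [← Finset.mul_sum, ← hcons]
    rw [Finset.sum_range_succ' _ (k + 1), Finset.sum_range_succ' _ k]
    simp only [Nat.choose_succ_succ, Nat.cast_add, add_mul, Finset.sum_add_distrib]
    rw [Finset.sum_range_succ (fun m => (k.choose (m + 1) : ℝ) * _) k]
    simp
    ring

/-- Normalising constants. -/
noncomputable def cco (s : ℝ) (a : ℕ) : ℝ := 2 ^ a * ffac (s / 2) a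

lemma cco_succ (s : ℝ) (a : ℕ) : cco s (a + 1) = cco s a * (s - 2 * a) := by
  unfold cco ffac
  rw [Finset.prod_range_succ, pow_succ]
  ring

lemma cco_zero (s : ℝ) : cco s 0 = 1 := by simp [cco, ffac]

lemma ffac_self (l : ℕ) : ffac l l = l.factorial := by
  rw [ffac, ← Finset.prod_range_add_one_eq_factorial, ← Finset.prod_range_reflect]
  push_cast
  apply Finset.prod_congr rfl
  intro j hj
  rw [Finset.mem_range] at hj
  rw [Nat.cast_sub (by omega), Nat.cast_sub (by omega)]
  push_cast; ring

lemma ffac_gt (l a : ℕ) (h : l < a) : ffac l a = 0 := by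
  rw [ffac, Finset.prod_eq_zero (Finset.mem_range.2 h)]
  simp

lemma cco_gt (l a : ℕ) (h : l < a) : cco (2 * l) a = 0 := by
  rw [cco, show (2 * (l : ℝ)) / 2 = l by ring, ffac_gt l a h, mul_zero]

lemma cco_self (l : ℕ) : cco (2 * l) l = 2 ^ l * l.factorial := by
  rw [cco, show (2 * (l : ℝ)) / 2 = l by ring, ffac_self]

lemma ffac_nat (n j : ℕ) : ffac n j = n.descFactorial j := by
  induction j with
  | zero => simp [ffac]
  | succ j ih =>
    rw [ffac, Finset.prod_range_succ, ← ffac, ih, Nat.descFactorial_succ]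
    push_cast
    by_cases h : j ≤ n
    · rw [Nat.cast_sub h]; ring
    · rw [Nat.descFactorial_of_lt (by omega)]; simp

lemma gchoose_nat (n j : ℕ) : gchoose n j = n.choose j := by
  rw [gchoose, ffac_nat, Nat.descFactorial_eq_factorial_mul_choose]
  have : (j.factorial : ℝ) ≠ 0 := by positivity
  push_cast
  field_simp

lemma hv_rpow {N : ℕ} (s : ℝ) (a : ℕ) (x : EuclideanSpace ℝ (Fin N)) (hx : x ≠ 0) :
    HasFDerivAt (fun x : EuclideanSpace ℝ (Fin N) => cco s a * ‖x‖ ^ (s - 2 * a))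
      ((cco s (a + 1) * ‖x‖ ^ (s - 2 * ((a + 1 : ℕ) : ℝ))) • innerSL ℝ x) x := by
  have e : ∀ (x : EuclideanSpace ℝ (Fin N)) (p : ℝ), ‖x‖ ^ p = (‖x‖ ^ 2) ^ (p / 2) := by
    intro x p
    rw [← Real.rpow_natCast, ← Real.rpow_mul (norm_nonneg _)]
    congr 1; push_cast; ring
  have h1 := (hasStrictFDerivAt_norm_sq x).hasFDerivAt
  have h2 := (h1.rpow_const (p := (s - 2 * a) / 2) (Or.inl (by positivity))).const_mul (cco s a)
  have h3 : (fun x : EuclideanSpace ℝ (Fin N) => cco s a * ‖x‖ ^ (s - 2 * a)) =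
    fun x => cco s a * (‖x‖ ^ 2) ^ ((s - 2 * a) / 2) := by
    funext x; rw [e]
  rw [h3]
  refine h2.congr_fderiv ?_
  rw [e x (s - _), cco_succ]
  ext w
  simp
  rw [show (s - 2 * ((a : ℝ) + 1)) / 2 = (s - 2 * a) / 2 - 1 by ring]
  ring

lemma hv_pow {N : ℕ} (l : ℕ) (a : ℕ) (x : EuclideanSpace ℝ (Fin N)) :
    HasFDerivAt (fun x : EuclideanSpace ℝ (Fin N) => cco (2 * l) a * (‖x‖ ^ 2) ^ (l - a))
      ((cco (2 * l) (a + 1) * (‖x‖ ^ 2) ^ (l - (a + 1))) • innerSL ℝ x) x := by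
  have h1 := (hasStrictFDerivAt_norm_sq x).hasFDerivAt
  have h2 := (h1.pow (l - a)).const_mul (cco (2 * l) a)
  refine h2.congr_fderiv ?_
  rw [cco_succ]
  ext w
  simp
  by_cases h : a ≤ l
  · rw [Nat.cast_sub h, show l - (a + 1) = l - a - 1 by omega]
    ring
  · rw [cco_gt l a (by omega)]; simp

lemma pdIter_pow {N : ℕ} (l : ℕ) (L : List (Fin N)) (hL : L.length = 2 * l)
    (y : EuclideanSpace ℝ (Fin N)) :
    pdIter L (fun z => ‖z‖ ^ (2 * l)) y = kap L * (2 ^ l * l.factorial) := by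
  have h := pdIter_eq Set.univ isOpen_univ
    (fun a (x : EuclideanSpace ℝ (Fin N)) => cco (2 * l) a * (‖x‖ ^ 2) ^ (l - a))
    (fun a x _ => hv_pow l a x) L y trivial
  have e : (fun z : EuclideanSpace ℝ (Fin N) => ‖z‖ ^ (2 * l)) =
    fun x => cco (2 * l) 0 * (‖x‖ ^ 2) ^ (l - 0) := by
    funext x; rw [cco_zero, pow_mul]; simp
  rw [e, h, lfun_eq_sum _ _ ((gx y L).natDegree + l + 1) (by omega),
    Finset.sum_eq_single_of_mem l (by simp)]
  · rw [coeff_gx_eq y L l hL.symm, cco_self, kap, hL]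
    simp
  · intro b _ hb
    rcases lt_or_gt_of_ne hb with hb | hb
    · rw [coeff_gx_lt y L b (by omega), zero_mul]
    · rw [cco_gt l b hb]; simp

lemma lfun_mul_monomial (c : ℕ → ℝ) (P : Polynomial ℝ) (q : ℕ) (r : ℝ) :
    lfun c (P * Polynomial.monomial q r) = r * lfun (fun a => c (a + q)) P := by
  induction P using Polynomial.induction_on' with
  | add p q hp hq => rw [add_mul, map_add, map_add, hp, hq]; ring
  | monomial n a =>
    rw [Polynomial.monomial_mul_monomial, lfun_monomial, lfun_monomial]; ring

/-- The inner sum. -/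
noncomputable def acoef (k : ℕ) (s : ℝ) (l : ℕ) : ℝ :=
  ∑ n ∈ Finset.Icc ((k + 1) / 2) (k - l),
    (2 : ℝ) ^ (2 * n - k) * gchoose (s / 2) n * gchoose (n : ℝ) (k - n) *
      gchoose ((k - n : ℕ) : ℝ) l

lemma natDegree_hmt (t : ℝ) (m : ℕ) :
    (hmt Polynomial.X (Polynomial.C t) m).natDegree ≤ m := by
  rw [Polynomial.natDegree_le_iff_coeff_eq_zero]
  intro b hb
  rw [coeff_hmt, if_neg (by omega)]

lemma pdIter_rpow {n : ℕ} (s r : ℝ) (hr : 0 < r) (k : ℕ) (L : List (Fin (n + 1)))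
    (hL : L.length = k) :
    pdIter L (fun z => ‖z‖ ^ s) (EuclideanSpace.single 0 r) =
      if (nz L).length % 2 = 1 then 0 else
        r ^ (s - k) * (k - (nz L).length).factorial * acoef k s ((nz L).length / 2) *
          (kap (nz L) * (2 ^ ((nz L).length / 2) * ((nz L).length / 2).factorial)) := by
  have hne : (EuclideanSpace.single 0 r : EuclideanSpace ℝ (Fin (n + 1))) ≠ 0 := by
    intro h; have := congrArg norm h; simp at this; exact hr.ne' this
  have h := pdIter_eq ({0}ᶜ : Set (EuclideanSpace ℝ (Fin (n + 1)))) isOpen_compl_singleton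
    (fun a (x : EuclideanSpace ℝ (Fin (n + 1))) => cco s a * ‖x‖ ^ (s - 2 * a))
    (fun a x hx => by simpa using hv_rpow s a x hx) L _ hne
  have e : (fun z : EuclideanSpace ℝ (Fin (n + 1)) => ‖z‖ ^ s) =
    fun x => cco s 0 * ‖x‖ ^ (s - 2 * (0 : ℕ)) := by
    funext x; rw [cco_zero]; simp
  rw [e, h, gx_axis]
  split_ifs with hodd
  · rw [gx_zero_odd _ hodd, mul_zero, map_zero]
  obtain ⟨q, hq⟩ : ∃ q, (nz L).length = 2 * q := ⟨(nz L).length / 2, by omega⟩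
  have hlen := nz_length L
  rw [gx_zero_even _ q hq, lfun_mul_monomial,
    lfun_eq_sum _ _ (L.count 0 + 1) (by have := natDegree_hmt r (L.count 0); omega)]
  rw [hq, show 2 * q / 2 = q by omega]
  have hK : L.count 0 = k - 2 * q := by omega
  have hkq : 2 * q ≤ k := by omega
  rw [hK, acoef]
  rw [show r ^ (s - k) * ((k - 2 * q).factorial : ℝ) *
      (∑ n ∈ Finset.Icc ((k + 1) / 2) (k - q),
        (2 : ℝ) ^ (2 * n - k) * gchoose (s / 2) n * gchoose (n : ℝ) (k - n) *
        gchoose ((k - n : ℕ) : ℝ) q) * (kap (nz L) * (2 ^ q * (q.factorial : ℝ))) =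
      kap (nz L) * ((r ^ (s - k) * ((k - 2 * q).factorial : ℝ) * (2 ^ q * (q.factorial : ℝ))) *
      (∑ n ∈ Finset.Icc ((k + 1) / 2) (k - q),
        (2 : ℝ) ^ (2 * n - k) * gchoose (s / 2) n * gchoose (n : ℝ) (k - n) *
        gchoose ((k - n : ℕ) : ℝ) q)) by ring]
  congr 1
  rw [Finset.mul_sum]
  symm
  apply Finset.sum_of_injOn (fun n => n - q)
  · intro a ha b hb hab
    simp only [Finset.coe_Icc, Set.mem_Icc] at ha hb hab
    omega
  · intro a ha
    simp only [Finset.coe_Icc, Set.mem_Icc, Finset.coe_range, Set.mem_Iio] at ha ⊢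
    omega
  · intro b hb hb'
    rw [Finset.mem_range] at hb
    rw [coeff_hmt, if_neg, zero_mul]
    intro hc
    apply hb'
    refine ⟨b + q, ?_, by simp⟩
    simp only [Finset.coe_Icc, Set.mem_Icc]
    omega
  · intro a ha
    rw [Finset.mem_Icc] at ha
    rw [coeff_hmt, if_pos (by omega)]
    obtain ⟨j, hj⟩ := Nat.exists_eq_add_of_le ha.2
    obtain ⟨p, hp⟩ : ∃ p, 2 * a = k + p := ⟨2 * a - k, by omega⟩
    rw [show a - q + q = a by omega, show 2 * (a - q) - (k - 2 * q) = p by omega,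
      show k - 2 * q - (a - q) = j by omega, show 2 * a - k = p by omega,
      gchoose_nat, gchoose_nat]
    have c1 : (a.choose (k - a) : ℝ) = a.factorial / ((k - a).factorial * p.factorial) := by
      rw [Nat.cast_choose ℝ (by omega), show a - (k - a) = p by omega]
    have c2 : ((k - a).choose q : ℝ) = (k - a).factorial / (q.factorial * j.factorial) := by
      rw [Nat.cast_choose ℝ (by omega), show k - a - q = j by omega]
    have hn : ‖(EuclideanSpace.single 0 r : EuclideanSpace ℝ (Fin (n + 1)))‖ = r := by
      simp [abs_of_pos hr]
    have hrr : r ^ (s - k) = r ^ p * r ^ (s - 2 * a) := by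
      rw [← Real.rpow_natCast, ← Real.rpow_add hr]
      congr 1
      have : (2 : ℝ) * a = k + p := by exact_mod_cast hp
      linarith
    have h2 : (2 : ℝ) ^ q * 2 ^ p * 2 ^ j = 2 ^ a := by
      rw [← pow_add, ← pow_add]; congr 1; omega
    rw [c1, c2, hn, hrr, cco, gchoose, ← h2]
    have i1 : (a.factorial : ℝ) ≠ 0 := by positivity
    have i2 : ((k - a).factorial : ℝ) ≠ 0 := by positivity
    have i3 : (p.factorial : ℝ) ≠ 0 := by positivity
    have i4 : (q.factorial : ℝ) ≠ 0 := by positivity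
    have i5 : (j.factorial : ℝ) ≠ 0 := by positivity
    field_simp

lemma gradSq_axis {n : ℕ} (s r : ℝ) (hr : 0 < r) (k : ℕ) (y : EuclideanSpace ℝ (Fin n)) :
    gradSq (n + 1) k (fun z => ‖z‖ ^ s) (EuclideanSpace.single 0 r) =
    (r ^ (s - k)) ^ 2 * ((Nat.factorial k : ℝ) *
        ∑ l ∈ Finset.range (k / 2 + 1),
          ((Nat.factorial (k - 2 * l) : ℝ) / (Nat.factorial (2 * l) : ℝ)) *
            (acoef k s l) ^ 2 *
            gradSq n (2 * l) (fun z => ‖z‖ ^ (2 * l)) y) := by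
  unfold gradSq
  obtain ⟨φ, hφ⟩ : ∃ φ : List (Fin n) → ℝ, ∀ L, φ L = (if L.length % 2 = 1 then 0 else
        r ^ (s - k) * (k - L.length).factorial * acoef k s (L.length / 2) *
          (kap L * (2 ^ (L.length / 2) * (L.length / 2).factorial))) ^ 2 := ⟨_, fun _ => rfl⟩
  have e1 : ∀ i : Fin k → Fin (n + 1),
    pdIter (List.ofFn i) (fun z => ‖z‖ ^ s) (EuclideanSpace.single 0 r) ^ 2 =
      φ (nz (List.ofFn i)) := by
    intro i
    rw [pdIter_rpow s r hr k _ (by simp), hφ]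
  rw [Finset.sum_congr rfl (fun i _ => e1 i), sum_nz k φ]
  simp only [hφ]
  rw [Finset.mul_sum, Finset.mul_sum]
  symm
  apply Finset.sum_of_injOn (fun l => 2 * l)
  · intro a _ b _ hab
    simp only at hab
    omega
  · intro a ha
    simp only [Finset.coe_range, Set.mem_Iio] at ha ⊢
    omega
  · intro m hm hm'
    rw [Finset.mem_range] at hm
    have : m % 2 = 1 := by
      by_contra hc
      apply hm'
      refine ⟨m / 2, ?_, ?_⟩
      · simp only [Finset.coe_range, Set.mem_Iio]; omega
      · simp only; omega
    simp [this]
  · intro l hl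
    rw [Finset.mem_range] at hl
    have hk : 2 * l ≤ k := by omega
    simp only [List.length_ofFn, show 2 * l % 2 ≠ 1 by omega, if_false,
      show 2 * l / 2 = l by omega]
    have e2 : ∀ i : Fin (2 * l) → Fin n, pdIter (List.ofFn i) (fun z => ‖z‖ ^ (2 * l)) y =
      kap (List.ofFn i) * (2 ^ l * l.factorial) := fun i => pdIter_pow l _ (by simp) y
    simp only [e2]
    rw [Nat.cast_choose ℝ hk]
    simp only [Finset.mul_sum]
    apply Finset.sum_congr rfl
    intro i _
    have i1 : ((2 * l).factorial : ℝ) ≠ 0 := by positivity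
    have i2 : ((k - 2 * l).factorial : ℝ) ≠ 0 := by positivity
    field_simp

lemma hs_indep {E : Type*} [NormedAddCommGroup E] [InnerProductSpace ℝ E] {ι : Type*} [Fintype ι]
    [CompleteSpace E]
    (b c : OrthonormalBasis ι ℝ E) (k : ℕ) : ∀ (T : ContinuousMultilinearMap ℝ (fun _ : Fin k => E) ℝ),
    ∑ i : Fin k → ι, (T (fun a => b (i a))) ^ 2 = ∑ i : Fin k → ι, (T (fun a => c (i a))) ^ 2 := by
  have hcons : ∀ (k : ℕ) (d : OrthonormalBasis ι ℝ E)
      (T : ContinuousMultilinearMap ℝ (fun _ : Fin (k + 1) => E) ℝ),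
      ∑ i : Fin (k + 1) → ι, (T (fun a => d (i a))) ^ 2 =
      ∑ j, ∑ i : Fin k → ι, (T.curryLeft (d j) (fun a => d (i a))) ^ 2 := by
    intro k d T
    rw [← Fintype.sum_prod_type', ← (Fin.consEquiv (fun _ => ι)).sum_comp]
    apply Finset.sum_congr rfl
    rintro ⟨j, i⟩ _
    rw [ContinuousMultilinearMap.curryLeft_apply]
    congr 2
    funext a
    cases a using Fin.cases <;> simp [Fin.consEquiv]
  have hlin : ∀ (d : OrthonormalBasis ι ℝ E) (f : E →L[ℝ] ℝ),
      ∑ j, (f (d j)) ^ 2 = ‖(InnerProductSpace.toDual ℝ E).symm f‖ ^ 2 := by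
    intro d f
    rw [← d.sum_sq_norm_inner_right]
    apply Finset.sum_congr rfl
    intro j _
    rw [real_inner_comm, InnerProductSpace.toDual_symm_apply, Real.norm_eq_abs, sq_abs]
  induction k with
  | zero =>
    intro T
    apply Finset.sum_congr rfl
    intro i _
    congr 2
    funext a; exact a.elim0
  | succ k ih =>
    intro T
    rw [hcons, hcons]
    simp only [ih]
    rw [Finset.sum_comm, Finset.sum_comm (s := Finset.univ (α := ι))]
    apply Finset.sum_congr rfl
    intro i _
    have h1 := hlin b (T.curryLeft.flipMultilinear (fun a => c (i a)))
    have h2 := hlin c (T.curryLeft.flipMultilinear (fun a => c (i a)))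
    simp only [ContinuousLinearMap.flipMultilinear_apply_apply] at h1 h2
    rw [h1, h2]

lemma pdIter_iterated {N : ℕ} (U : Set (EuclideanSpace ℝ (Fin N))) (hU : IsOpen U)
    (u : EuclideanSpace ℝ (Fin N) → ℝ) (hu : ∀ x ∈ U, ContDiffAt ℝ (⊤ : ℕ∞) u x) (k : ℕ) :
    ∀ (i : Fin k → Fin N), ∀ x ∈ U, pdIter (List.ofFn i) u x =
      iteratedFDeriv ℝ k u x (fun a => EuclideanSpace.single (i a) 1) := by
  induction k with
  | zero => intro i x _; simp [pdIter]
  | succ k ih =>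
    intro i x hx
    rw [List.ofFn_succ]
    have e : pdIter (i 0 :: List.ofFn fun a => i a.succ) u x =
      fderiv ℝ (pdIter (List.ofFn fun a => i a.succ) u) x (EuclideanSpace.single (i 0) 1) := rfl
    have : pdIter (List.ofFn fun a => i a.succ) u =ᶠ[nhds x] fun x =>
        iteratedFDeriv ℝ k u x (fun a => EuclideanSpace.single (i a.succ) 1) := by
      filter_upwards [hU.mem_nhds hx] with y hy
      exact ih _ y hy
    have hd := ((hu x hx).differentiableAt_iteratedFDeriv (m := k)
      (by exact_mod_cast WithTop.coe_lt_top k)).hasFDerivAt.continuousMultilinear_apply_const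
      (fun a => EuclideanSpace.single (i a.succ) (1 : ℝ))
    rw [e, this.fderiv_eq, hd.fderiv, iteratedFDeriv_succ_apply_left]
    rfl

lemma gradSq_rot {N : ℕ} (k : ℕ) (s : ℝ) (R : EuclideanSpace ℝ (Fin N) ≃ₗᵢ[ℝ] EuclideanSpace ℝ (Fin N))
    (x : EuclideanSpace ℝ (Fin N)) (hx : x ≠ 0) :
    gradSq N k (fun z => ‖z‖ ^ s) x = gradSq N k (fun z => ‖z‖ ^ s) (R x) := by
  have hu : ∀ x ∈ ({0}ᶜ : Set (EuclideanSpace ℝ (Fin N))),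
      ContDiffAt ℝ (⊤ : ℕ∞) (fun z : EuclideanSpace ℝ (Fin N) => ‖z‖ ^ s) x := by
    intro x hx
    exact (contDiffAt_norm ℝ hx).rpow_const_of_ne (norm_ne_zero_iff.2 hx)
  have hRx : R x ≠ 0 := by simpa using hx
  unfold gradSq
  simp only [fun i => pdIter_iterated _ isOpen_compl_singleton _ hu k i x hx,
    fun i => pdIter_iterated _ isOpen_compl_singleton _ hu k i (R x) hRx]
  have e : (fun z : EuclideanSpace ℝ (Fin N) => ‖z‖ ^ s) = (fun z => ‖z‖ ^ s) ∘ R := by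
    funext z; simp
  have h := R.toContinuousLinearEquiv.iteratedFDerivWithin_comp_right
    (fun z : EuclideanSpace ℝ (Fin N) => ‖z‖ ^ s) uniqueDiffOn_univ (x := x) (Set.mem_univ _) k
  simp only [Set.preimage_univ, iteratedFDerivWithin_univ] at h
  have h' : iteratedFDeriv ℝ k (fun z : EuclideanSpace ℝ (Fin N) => ‖z‖ ^ s) x =
    (iteratedFDeriv ℝ k (fun z : EuclideanSpace ℝ (Fin N) => ‖z‖ ^ s) (R x)).compContinuousLinearMap
      fun _ => (R.toContinuousLinearEquiv : EuclideanSpace ℝ (Fin N) →L[ℝ] EuclideanSpace ℝ (Fin N)) := by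
    refine Eq.trans ?_ h
    conv_lhs => rw [e]
    rfl
  rw [h']
  have := hs_indep ((EuclideanSpace.basisFun (Fin N) ℝ).map R) (EuclideanSpace.basisFun (Fin N) ℝ) k
    (iteratedFDeriv ℝ k (fun z : EuclideanSpace ℝ (Fin N) => ‖z‖ ^ s) (R x))
  simpa using this

theorem stmt_12 (N : ℕ) (hN : 2 ≤ N) (k : ℕ) (s : ℝ)
    (x : EuclideanSpace ℝ (Fin N)) (hx : x ≠ 0)
    (y : EuclideanSpace ℝ (Fin (N - 1))) (hy : y ≠ 0) :
    ‖x‖ ^ (2 * ((k : ℝ) - s)) * gradSq N k (fun z => ‖z‖ ^ s) x =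
      (Nat.factorial k : ℝ) *
        ∑ l ∈ Finset.range (k / 2 + 1),
          ((Nat.factorial (k - 2 * l) : ℝ) / (Nat.factorial (2 * l) : ℝ)) *
            (∑ n ∈ Finset.Icc ((k + 1) / 2) (k - l),
              (2 : ℝ) ^ (2 * n - k) * gchoose (s / 2) n * gchoose (n : ℝ) (k - n) *
                gchoose ((k - n : ℕ) : ℝ) l) ^ 2 *
            gradSq (N - 1) (2 * l) (fun z => ‖z‖ ^ (2 * l)) y := by

  obtain ⟨n, rfl⟩ : ∃ n, N = n + 1 := ⟨N - 1, by omega⟩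
  have hr : 0 < ‖x‖ := norm_pos_iff.2 hx
  have hnorm : ‖x‖ = ‖(EuclideanSpace.single 0 ‖x‖ : EuclideanSpace ℝ (Fin (n + 1)))‖ := by simp
  rw [gradSq_rot k s _ x hx, Submodule.reflection_sub hnorm, gradSq_axis (n := n) s ‖x‖ hr k y]
  rw [← mul_assoc]
  have : ‖x‖ ^ (2 * ((k : ℝ) - s)) * (‖x‖ ^ (s - k)) ^ 2 = 1 := by
    rw [← Real.rpow_natCast, ← Real.rpow_mul hr.le, ← Real.rpow_add hr]
    push_cast
    rw [show 2 * ((k : ℝ) - s) + (s - k) * 2 = 0 by ring, Real.rpow_zero]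
  rw [this, one_mul]
  rfl
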